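/- arXiv:2206.03922 — 6 statements merged into one kernel-verified Lean document; each statement's English description precedes it below -/
import Mathlib

section
/- Let Γ be a finite game with a finite set of players N, finite pure-strategy sets A_i, and payoff functions u_i : ∏_j A_j → ℝ. In its mixed extension, each player chooses x_i in the probability simplex Δ(A_i), X = ∏_i Δ(A_i), the mixed payoff is u_i(x) = Σ_{a∈∏A_j} (∏_j x_{j,a_j}) u_i(a), and the payoff field is v_i(x) = (u_i(a_i; x_{−i}))_{a_i∈A_i}, v(x) = (v_i(x))_i. Then a mixed-strategy profile x* ∈ X is variationally stable — i.e., there is a neighborhood U of x* in X such that ⟨v(x), x − x*⟩ < 0 for all x ∈ U with x ≠ x* — if and only if x* is a strict Nash equilibrium of Γ, i.e., u_i(x*) > u_i(x_i; x*_{−i}) for every player i and every x_i ∈ Δ(A_i) with x_i ≠ x*_i. -/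
open Finset

variable {N : Type*} [Fintype N] [DecidableEq N]
  {A : N → Type*} [∀ i, Fintype (A i)] [∀ i, DecidableEq (A i)]

/-- The mixed extension of the payoff `u i` of player `i` in a finite game:
`U i x = ∑_{a} (∏_j x_j (a_j)) u i a`. -/
noncomputable def mixedPayoff (u : N → (∀ j, A j) → ℝ) (i : N)
    (x : ∀ j, A j → ℝ) : ℝ :=
  ∑ a : (∀ j, A j), (∏ j, x j (a j)) * u i a

/-- The vertex of the simplex `Δ(A i)` corresponding to the pure strategy `b : A i`. -/
def vertex (i : N) (b : A i) : A i → ℝ := fun c => if c = b then 1 else 0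

/-- The ensemble of payoff fields of the mixed extension of a finite game:
`payoffField u x i b = u_i (b ; x_{-i})` is the mixed payoff to player `i` of the pure
strategy `b` against the mixed profile `x_{-i}` of the opponents. -/
noncomputable def payoffField (u : N → (∀ j, A j) → ℝ)
    (x : ∀ j, A j → ℝ) : ∀ j, A j → ℝ :=
  fun i b => mixedPayoff u i (Function.update x i (vertex i b))

omit [∀ i, Fintype (A i)] [∀ i, DecidableEq (A i)] in
lemma prod_update_apply (x : ∀ j, A j → ℝ) (i : N) (y : A i → ℝ) (a : ∀ j, A j) :
    ∏ j, Function.update x i y j (a j) = y (a i) * ∏ j ∈ univ.erase i, x j (a j) := by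
  rw [← mul_prod_erase univ _ (mem_univ i), Function.update_self]
  congr 1
  refine prod_congr rfl fun j hj => ?_
  rw [Function.update_of_ne (ne_of_mem_erase hj)]

/-- The mixed payoff of a player is linear in that player's own strategy. -/
lemma mixedPayoff_update (u : N → (∀ j, A j) → ℝ) (x : ∀ j, A j → ℝ) (i : N) (y : A i → ℝ) :
    mixedPayoff u i (Function.update x i y) = ∑ b, payoffField u x i b * y b := by
  simp only [payoffField, mixedPayoff, prod_update_apply, vertex, sum_mul]
  rw [sum_comm]
  refine sum_congr rfl fun a _ => ?_
  rw [sum_eq_single (a i)]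
  · simp only [if_true]
    ring
  · intro b _ hb
    simp [hb.symm]
  · simp

lemma mixedPayoff_eq_sum (u : N → (∀ j, A j) → ℝ) (x : ∀ j, A j → ℝ) (i : N) :
    mixedPayoff u i x = ∑ b, payoffField u x i b * x i b := by
  rw [← mixedPayoff_update, Function.update_eq_self]

lemma payoffField_update_self (u : N → (∀ j, A j) → ℝ) (x : ∀ j, A j → ℝ) (i : N)
    (y : A i → ℝ) : payoffField u (Function.update x i y) i = payoffField u x i := by
  funext b
  simp [payoffField]

lemma continuous_payoffField (u : N → (∀ j, A j) → ℝ) (i : N) (b : A i) :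
    Continuous fun x => payoffField u x i b := by
  simp only [payoffField, mixedPayoff, prod_update_apply]
  fun_prop

omit [Fintype N] [DecidableEq N] in
lemma vertex_mem_stdSimplex (i : N) (b : A i) : vertex i b ∈ stdSimplex ℝ (A i) := by
  refine ⟨fun c => ?_, by simp [vertex]⟩
  unfold vertex
  split_ifs <;> norm_num

omit [Fintype N] [DecidableEq N] in
/-- A point of the simplex that strictly maximizes a linear functional is a vertex. -/
lemma exists_eq_vertex_of_strict_max (i : N) {w p : A i → ℝ} (hp : p ∈ stdSimplex ℝ (A i))
    (h : ∀ q ∈ stdSimplex ℝ (A i), q ≠ p → ∑ b, w b * q b < ∑ b, w b * p b) :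
    ∃ a, p = vertex i a := by
  by_contra! hne
  have hw : ∀ a, w a < ∑ b, w b * p b := fun a => by
    simpa [vertex] using h _ (vertex_mem_stdSimplex i a) (hne a).symm
  obtain ⟨a, -, ha⟩ : ∃ a ∈ univ, p a ≠ 0 :=
    exists_ne_zero_of_sum_ne_zero (by rw [hp.2]; exact one_ne_zero)
  have hlt : ∑ c, w c * p c < ∑ c, (∑ b, w b * p b) * p c :=
    sum_lt_sum (fun c _ => mul_le_mul_of_nonneg_right (hw c).le (hp.1 c))
      ⟨a, mem_univ a, mul_lt_mul_of_pos_right (hw a) ((hp.1 a).lt_of_ne' ha)⟩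
  rw [← mul_sum, hp.2, mul_one] at hlt
  exact lt_irrefl _ hlt

omit [Fintype N] [DecidableEq N] in
/-- If the coordinate `a` of `w` is strictly the largest, then `w` decreases strictly along every
direction of the simplex at the vertex of `a`. -/
lemma sum_mul_sub_vertex_neg (i : N) {w y : A i → ℝ} {a : A i} (hw : ∀ b, b ≠ a → w b < w a)
    (hy : y ∈ stdSimplex ℝ (A i)) (hne : y ≠ vertex i a) :
    ∑ b, w b * (y b - vertex i a b) < 0 := by
  have hle : ∀ b, w b ≤ w a := fun b => by
    rcases eq_or_ne b a with rfl | hb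
    exacts [le_rfl, (hw b hb).le]
  obtain ⟨c, hca, hc⟩ : ∃ c, c ≠ a ∧ y c ≠ 0 := by
    by_contra! hz
    refine hne (funext fun b => ?_)
    rcases eq_or_ne b a with rfl | hb
    · have := hy.2
      rw [sum_eq_single b (fun c _ hcb => hz c hcb) (by simp)] at this
      simp [vertex, this]
    · simp [vertex, hb, hz b hb]
  have hlt : ∑ b, w b * y b < ∑ b, w a * y b :=
    sum_lt_sum (fun b _ => mul_le_mul_of_nonneg_right (hle b) (hy.1 b))
      ⟨c, mem_univ c, mul_lt_mul_of_pos_right (hw c hca) ((hy.1 c).lt_of_ne' hc)⟩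
  rw [← mul_sum, hy.2, mul_one] at hlt
  simpa [mul_sub, sum_sub_distrib, vertex] using hlt

/-- **Variational stability and strict equilibria in finite games.**
A mixed strategy profile `xstar` of a finite game is variationally stable, i.e., there
is a neighborhood of `xstar` in `X = ∏_i Δ(A_i)` on which `⟨v(x), x - xstar⟩ < 0` for
all `x ≠ xstar`, if and only if `xstar` is a strict Nash equilibrium. -/
theorem variationallyStable_iff_strict_nash (u : N → (∀ j, A j) → ℝ)
    (X : Set (∀ j, A j → ℝ)) (hX : X = {x | ∀ i, x i ∈ stdSimplex ℝ (A i)})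
    (xstar : ∀ j, A j → ℝ) (hxstar : xstar ∈ X) :
    (∃ ε > 0, ∀ x ∈ X, x ≠ xstar → dist x xstar < ε →
        ∑ i, ∑ b : A i, payoffField u x i b * (x i b - xstar i b) < 0)
    ↔ (∀ i, ∀ xi ∈ stdSimplex ℝ (A i), xi ≠ xstar i →
        mixedPayoff u i (Function.update xstar i xi) < mixedPayoff u i xstar) := by
  subst hX
  constructor
  · rintro ⟨ε, hε, hstable⟩ i y hy hne
    let γ : ℝ → ∀ j, A j → ℝ := fun t => Function.update xstar i (xstar i + t • (y - xstar i))
    have hγ : Continuous γ := by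
      unfold γ
      fun_prop
    have hγ0 : γ 0 = xstar := by simp [γ]
    have hnear : ∀ᶠ t in nhdsWithin (0 : ℝ) (Set.Ioi 0), dist (γ t) xstar < ε :=
      ((hγ.tendsto' 0 xstar hγ0).mono_left nhdsWithin_le_nhds).eventually
        (Metric.ball_mem_nhds _ hε)
    obtain ⟨t, htε, ht0, ht1⟩ :=
      (hnear.and (Ioo_mem_nhdsGT (zero_lt_one' ℝ))).exists
    have hmem : ∀ j, γ t j ∈ stdSimplex ℝ (A j) := by
      intro j
      rcases eq_or_ne j i with rfl | hj
      · simpa [γ] using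
          (convex_stdSimplex ℝ (A j)).add_smul_sub_mem (hxstar j) hy ⟨ht0.le, ht1.le⟩
      · simpa [γ, hj] using hxstar j
    have hγne : γ t ≠ xstar := by
      intro h
      have h' := congrFun h i
      simp [γ, ht0.ne', sub_eq_zero, hne] at h'
    have hneg := hstable (γ t) hmem hγne htε
    rw [sum_eq_single i (fun j _ hj => by simp [γ, hj]) (by simp)] at hneg
    have hsum : ∑ b, payoffField u (γ t) i b * (γ t i b - xstar i b)
        = t * ∑ b, payoffField u xstar i b * (y b - xstar i b) := by
      rw [mul_sum, payoffField_update_self]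
      refine sum_congr rfl fun b _ => ?_
      simp only [γ, Function.update_self, Pi.add_apply, Pi.smul_apply, Pi.sub_apply, smul_eq_mul]
      ring
    rw [hsum] at hneg
    have hlt := neg_of_mul_neg_right hneg ht0.le
    rw [mixedPayoff_update, mixedPayoff_eq_sum]
    simpa [mul_sub, sum_sub_distrib] using hlt
  · intro hnash
    simp only [mixedPayoff_update, mixedPayoff_eq_sum u xstar] at hnash
    choose a ha using fun i => exists_eq_vertex_of_strict_max i (hxstar i) (hnash i)
    have hstrict : ∀ i b, b ≠ a i → payoffField u xstar i b < payoffField u xstar i (a i) := by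
      intro i b hb
      have hv : vertex i b ≠ xstar i := by
        rw [ha i]
        intro h
        have := congrFun h b
        simp [vertex, hb] at this
      have := hnash i _ (vertex_mem_stdSimplex i b) hv
      rw [ha i] at this
      simpa [vertex] using this
    have hnear : ∀ᶠ x in nhds xstar, ∀ i b, b ≠ a i →
        payoffField u x i b < payoffField u x i (a i) := by
      simp only [Filter.eventually_all]
      exact fun i b hb => (continuous_payoffField u i b).continuousAt.eventually_lt
        (continuous_payoffField u i (a i)).continuousAt (hstrict i b hb)
    obtain ⟨ε, hε, hball⟩ := Metric.eventually_nhds_iff.mp hnear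
    refine ⟨ε, hε, fun x hx hne hdist => ?_⟩
    obtain ⟨k, hk⟩ := Function.ne_iff.mp hne
    have hneg : ∀ i, x i ≠ xstar i →
        ∑ b, payoffField u x i b * (x i b - xstar i b) < 0 := by
      intro i hi
      rw [ha i] at hi ⊢
      exact sum_mul_sub_vertex_neg i (hball hdist i) (hx i) hi
    refine sum_neg' (fun i _ => ?_) ⟨k, mem_univ k, hneg k hk⟩
    by_cases hi : x i = xstar i
    · simp [hi]
    · exact (hneg i hi).le
end

section
/- Let X be a nonempty closed convex subset of ℝ^d, let v : ℝ^d → ℝ^d be continuously differentiable on a neighborhood of X, and let x* ∈ X be a critical point, i.e., ⟨v(x*), x − x*⟩ ≤ 0 for all x ∈ X. Suppose the second-order sufficiency condition holds: ⟨z, Dv(x*) z⟩ < 0 for every nonzero tangent vector z to X at x* (z in the tangent cone to X at x*), where Dv(x*) is the Fréchet derivative (Jacobian) of v at x*. Then x* is variationally stable: there exists a neighborhood U of x* in X such that ⟨v(x), x − x*⟩ < 0 for all x ∈ U with x ≠ x*. -/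
open Set
open scoped RealInnerProductSpace Topology

/-- A quadratic form that is negative on the nonzero vectors of a closed set is uniformly negative
on the unit vectors of that set. -/
theorem exists_pos_forall_inner_le_neg {E : Type*} [NormedAddCommGroup E] [InnerProductSpace ℝ E]
    [FiniteDimensional ℝ E] {T : Set E} (hT : IsClosed T) (A : E →L[ℝ] E)
    (hneg : ∀ z ∈ T, z ≠ 0 → ⟪z, A z⟫ < 0) :
    ∃ c > 0, ∀ z ∈ T, ‖z‖ = 1 → ⟪z, A z⟫ ≤ -c := by
  have : ProperSpace E := FiniteDimensional.proper ℝ E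
  have hK : IsCompact (Metric.sphere (0 : E) 1 ∩ T) := (isCompact_sphere 0 1).inter_right hT
  have hf : ContinuousOn (fun z : E => -⟪z, A z⟫) (Metric.sphere (0 : E) 1 ∩ T) := by fun_prop
  obtain ⟨c, hc, hle⟩ := hK.exists_forall_le' hf (a := 0) fun z hz =>
    neg_pos.2 (hneg z hz.2 (ne_zero_of_mem_unit_sphere ⟨z, hz.1⟩))
  exact ⟨c, hc, fun z hz h1 => le_neg.1 (hle z ⟨by simpa using h1, hz⟩)⟩

/-- **Second-order sufficiency implies variational stability.**
Let `xstar` be a critical point of a continuously differentiable field `v` on a closed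
convex set `X`. If `⟨z, Dv(xstar) z⟩ < 0` for every nonzero tangent vector `z` to `X` at
`xstar`, then `xstar` is variationally stable: `⟨v x, x - xstar⟩ < 0` for all `x ≠ xstar`
in a neighborhood of `xstar` in `X`. -/
theorem variationallyStable_of_secondOrder {d : ℕ}
    (X : Set (EuclideanSpace ℝ (Fin d)))
    (hXne : X.Nonempty) (hXcl : IsClosed X) (hXcv : Convex ℝ X)
    (v : EuclideanSpace ℝ (Fin d) → EuclideanSpace ℝ (Fin d))
    (hv : ∃ O, IsOpen O ∧ X ⊆ O ∧ ContDiffOn ℝ 1 v O)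
    (xstar : EuclideanSpace ℝ (Fin d)) (hx : xstar ∈ X)
    (hcrit : ∀ x ∈ X, ⟪v xstar, x - xstar⟫ ≤ 0)
    (hSOS : ∀ z ∈ closure {z : EuclideanSpace ℝ (Fin d) |
        ∃ x ∈ X, ∃ l : ℝ, 0 ≤ l ∧ z = l • (x - xstar)}, z ≠ 0 →
      ⟪z, fderiv ℝ v xstar z⟫ < 0) :
    ∃ ε > 0, ∀ x ∈ X, x ≠ xstar → ‖x - xstar‖ < ε → ⟪v x, x - xstar⟫ < 0 := by
  obtain ⟨O, hO, hXO, hvO⟩ := hv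
  have hderiv : HasFDerivAt v (fderiv ℝ v xstar) xstar :=
    ((hvO.contDiffAt (hO.mem_nhds (hXO hx))).differentiableAt one_ne_zero).hasFDerivAt
  obtain ⟨c, hc, hquad⟩ := exists_pos_forall_inner_le_neg isClosed_closure (fderiv ℝ v xstar) hSOS
  obtain ⟨ε, hε, hball⟩ := Metric.eventually_nhds_iff.1
    (hderiv.isLittleO.bound (half_pos hc))
  refine ⟨ε, hε, fun x hxX hne hxε => ?_⟩
  have hrem := hball (by rwa [dist_eq_norm])
  have hcx := hcrit x hxX
  set h := x - xstar
  have hpos : 0 < ‖h‖ := norm_pos_iff.2 (sub_ne_zero.2 hne)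
  have hdir : ⟪h, fderiv ℝ v xstar h⟫ ≤ -c * ‖h‖ ^ 2 := by
    have hunit := hquad (‖h‖⁻¹ • h)
      (subset_closure ⟨x, hxX, ‖h‖⁻¹, by positivity, rfl⟩)
      (by rw [norm_smul, norm_inv, norm_norm, inv_mul_cancel₀ hpos.ne'])
    rw [map_smul, real_inner_smul_left, real_inner_smul_right] at hunit
    calc ⟪h, fderiv ℝ v xstar h⟫
        = ‖h‖⁻¹ * (‖h‖⁻¹ * ⟪h, fderiv ℝ v xstar h⟫) * ‖h‖ ^ 2 := by field_simp
      _ ≤ -c * ‖h‖ ^ 2 := by gcongr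
  have hinner : ⟪v x - v xstar - fderiv ℝ v xstar h, h⟫ ≤ c / 2 * ‖h‖ * ‖h‖ :=
    (real_inner_le_norm _ _).trans (by gcongr)
  rw [inner_sub_left, inner_sub_left, real_inner_comm h (fderiv ℝ v xstar h)] at hinner
  nlinarith [mul_pos hc (pow_pos hpos 2)]
end

section
/- Fix N ∈ ℕ and dimensions d_1, …, d_N, let E = ∏_{j=1}^N ℝ^{d_j} with the Euclidean structure, and let f : E → ℝ be differentiable with L-Lipschitz gradient (‖∇f(x') − ∇f(x)‖ ≤ L‖x' − x‖ for all x, x'). Fix δ > 0 and x ∈ E, and let w = (w_1, …, w_N) be a random vector whose components are independent, with each w_j drawn uniformly from the 2d_j signed standard basis vectors {±e_1, …, ±e_{d_j}} of ℝ^{d_j}. Then for each index i, the single-point estimator satisfies ‖E[(d_i/δ) f(x + δ w) w_i] − ∇_{x_i} f(x)‖ ≤ (d_i L N / 2) δ, where ∇_{x_i} f(x) denotes the block of ∇f(x) corresponding to the i-th factor ℝ^{d_i}. -/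
open Finset
open scoped RealInnerProductSpace

/-- The descent lemma: a first-order Taylor bound for a function with Lipschitz gradient. -/
theorem abs_sub_sub_inner_gradient_le {E : Type*} [NormedAddCommGroup E] [InnerProductSpace ℝ E]
    [CompleteSpace E] {f : E → ℝ} {K : NNReal} (hf : Differentiable ℝ f)
    (hK : LipschitzWith K (gradient f)) (x v : E) :
    |f (x + v) - f x - ⟪gradient f x, v⟫| ≤ K / 2 * ‖v‖ ^ 2 := by
  have hφ (t : ℝ) : HasDerivAt (fun t : ℝ => f (x + t • v) - f x - t * ⟪gradient f x, v⟫)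
      (⟪gradient f (x + t • v) - gradient f x, v⟫) t := by
    have hline : HasDerivAt (fun t : ℝ => x + t • v) v t := by
      simpa using ((hasDerivAt_id t).smul_const v).const_add x
    have hcomp := (hf (x + t • v)).hasGradientAt.hasFDerivAt.comp_hasDerivAt t hline
    rw [inner_sub_left]
    refine ((hcomp.sub_const (f x)).sub
      ((hasDerivAt_id t).mul_const ⟪gradient f x, v⟫)).congr_deriv ?_
    simp
  have hB (t : ℝ) : HasDerivAt (fun t : ℝ => K / 2 * ‖v‖ ^ 2 * t ^ 2) (K * ‖v‖ ^ 2 * t) t := by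
    refine ((hasDerivAt_pow 2 t).const_mul (K / 2 * ‖v‖ ^ 2 : ℝ)).congr_deriv ?_
    push_cast
    ring
  have hbound := image_norm_le_of_norm_deriv_right_le_deriv_boundary
    (a := 0) (b := 1)
    (fun t _ => (hφ t).continuousAt.continuousWithinAt)
    (fun t _ => (hφ t).hasDerivWithinAt) (by simp) hB
    (fun t ht => ?_) (Set.right_mem_Icc.2 zero_le_one)
  · simpa using hbound
  · calc ‖⟪gradient f (x + t • v) - gradient f x, v⟫‖
        ≤ ‖gradient f (x + t • v) - gradient f x‖ * ‖v‖ := norm_inner_le_norm _ _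
      _ ≤ K * ‖x + t • v - x‖ * ‖v‖ := by gcongr; exact hK.norm_sub_le _ _
      _ = K * ‖v‖ ^ 2 * t := by
        rw [add_sub_cancel_left, norm_smul, Real.norm_of_nonneg ht.1]
        ring

/-- The signed standard basis vector of `ℝⁿ` with the given sign and coordinate. -/
noncomputable def signedBasisVector {n : ℕ} (a : Bool × Fin n) : EuclideanSpace ℝ (Fin n) :=
  (if a.1 then (1 : ℝ) else -1) • EuclideanSpace.single a.2 1

theorem norm_signedBasisVector {n : ℕ} (a : Bool × Fin n) : ‖signedBasisVector a‖ = 1 := by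
  rcases a with ⟨_ | _, k⟩ <;> simp [signedBasisVector]

theorem sum_affine_smul_signedBasisVector {n : ℕ} (c δ : ℝ) (g : EuclideanSpace ℝ (Fin n)) :
    ∑ a : Bool × Fin n, (c + δ * ⟪g, signedBasisVector a⟫) • signedBasisVector a
      = (2 * δ) • g := by
  ext k
  simp [signedBasisVector, Fintype.sum_prod_type, EuclideanSpace.inner_single_right,
    Pi.single_apply]
  ring

theorem sum_affine_smul_signedBasisVector_apply {ι : Type*} [Fintype ι] [DecidableEq ι]
    (d : ι → ℕ) (i : ι) (hi : 0 < d i) (c δ : ℝ) (g : ∀ j, EuclideanSpace ℝ (Fin (d j))) :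
    ∑ s : (∀ j, Bool × Fin (d j)),
        (c + δ * ∑ j, ⟪g j, signedBasisVector (s j)⟫) • signedBasisVector (s i)
      = (Fintype.card (∀ j, Bool × Fin (d j)) * (δ / d i)) • g i := by
  have hcard := Fintype.card_congr (Equiv.piSplitAt i fun j => Bool × Fin (d j))
  rw [← (Equiv.piSplitAt i fun j => Bool × Fin (d j)).symm.sum_comp, Fintype.sum_prod_type_right,
    hcard]
  have hsum (r : ∀ j : {j // j ≠ i}, Bool × Fin (d j)) :
      ∑ a : Bool × Fin (d i),
        (c + δ * ∑ j, ⟪g j, signedBasisVector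
          ((Equiv.piSplitAt i fun j => Bool × Fin (d j)).symm (a, r) j)⟫) •
          signedBasisVector ((Equiv.piSplitAt i fun j => Bool × Fin (d j)).symm (a, r) i)
        = (2 * δ) • g i := by
    rw [← sum_affine_smul_signedBasisVector
      (c + δ * ∑ j : {j // j ≠ i}, ⟪g j, signedBasisVector (r j)⟫) δ (g i)]
    refine Finset.sum_congr rfl fun a _ => ?_
    rw [Fintype.sum_eq_add_sum_subtype_ne _ i]
    have hne (j : {j // j ≠ i}) :
        (Equiv.piSplitAt i fun j => Bool × Fin (d j)).symm (a, r) j = r j := by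
      simp [Equiv.piSplitAt, j.2]
    simp only [hne]
    simp only [Equiv.piSplitAt_symm_apply, dite_true]
    congr 1
    ring
  have hi' : (d i : ℝ) ≠ 0 := by positivity
  rw [Finset.sum_congr rfl fun r _ => hsum r, Finset.sum_const, Finset.card_univ,
    ← Nat.cast_smul_eq_nsmul ℝ, smul_smul]
  congr 1
  rw [Fintype.card_prod, Fintype.card_prod, Fintype.card_bool, Fintype.card_fin]
  push_cast
  field_simp

/-- **Bias of the single-point SPSA gradient estimator.**
Let `f` be differentiable with `L`-Lipschitz gradient on `E = ∏_j ℝ^{d j}`, and let the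
perturbation `w` have independent components, each uniform over the `2 d j` signed
standard basis vectors of `ℝ^{d j}` (encoded by averaging over all sign/coordinate
choices `s`). Then, for each block `i`, the bias of the single-point estimator
`(d i / δ) f (x + δ w) w i` with respect to `∇_{x_i} f (x)` is at most
`(d i * L * N / 2) * δ`. -/
theorem spsa_bias_bound {Np : ℕ} (d : Fin Np → ℕ) (hd : ∀ j, 0 < d j)
    (L δ : ℝ) (hL : 0 ≤ L) (hδ : 0 < δ)
    (f : PiLp 2 (fun j : Fin Np => EuclideanSpace ℝ (Fin (d j))) → ℝ)
    (hdiff : Differentiable ℝ f)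
    (hLip : LipschitzWith (Real.toNNReal L) (gradient f))
    (x : PiLp 2 (fun j : Fin Np => EuclideanSpace ℝ (Fin (d j))))
    (w : (∀ j : Fin Np, Bool × Fin (d j)) →
      PiLp 2 (fun j : Fin Np => EuclideanSpace ℝ (Fin (d j))))
    (hw : ∀ s j, w s j =
      (if (s j).1 then (1 : ℝ) else -1) • EuclideanSpace.single (s j).2 1)
    (i : Fin Np) :
    ‖(Fintype.card (∀ j : Fin Np, Bool × Fin (d j)) : ℝ)⁻¹ •
        (∑ s : (∀ j : Fin Np, Bool × Fin (d j)),
          ((d i : ℝ) / δ * f (x + δ • w s)) • w s i)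
      - gradient f x i‖ ≤ (d i : ℝ) * L * Np / 2 * δ := by
  have hw' (s j) : w s j = signedBasisVector (s j) := hw s j
  have hdi : (0 : ℝ) < d i := by exact_mod_cast hd i
  have : ∀ j, Nonempty (Fin (d j)) := fun j => ⟨⟨0, hd j⟩⟩
  set M : ℝ := (Fintype.card (∀ j : Fin Np, Bool × Fin (d j)) : ℝ)
  have hM : 0 < M := Nat.cast_pos.2 Fintype.card_pos
  have hnorm (s) : ‖w s‖ ^ 2 = Np := by
    simp [PiLp.norm_sq_eq_of_L2, hw', norm_signedBasisVector]
  set R : (∀ j : Fin Np, Bool × Fin (d j)) → ℝ :=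
    fun s => f (x + δ • w s) - f x - ⟪gradient f x, δ • w s⟫ with hR
  have hRle (s) : |R s| ≤ L / 2 * (δ ^ 2 * Np) := by
    have h := abs_sub_sub_inner_gradient_le hdiff hLip x (δ • w s)
    rwa [norm_smul, mul_pow, hnorm, Real.norm_of_nonneg hδ.le, Real.coe_toNNReal L hL] at h
  have hlinear : ∑ s, (f x + ⟪gradient f x, δ • w s⟫) • w s i
      = (M * (δ / d i)) • gradient f x i := by
    rw [← sum_affine_smul_signedBasisVector_apply d i (hd i) (f x) δ fun j => gradient f x j]
    simp only [inner_smul_right, PiLp.inner_apply, hw']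
  have hbias : M⁻¹ • (∑ s, ((d i : ℝ) / δ * f (x + δ • w s)) • w s i) - gradient f x i
      = (M⁻¹ * (d i / δ)) • ∑ s, R s • w s i := by
    have hsplit : ∑ s, f (x + δ • w s) • w s i
        = (M * (δ / d i)) • gradient f x i + ∑ s, R s • w s i := by
      rw [← hlinear, ← Finset.sum_add_distrib]
      refine Finset.sum_congr rfl fun s _ => ?_
      rw [← add_smul]
      congr 1
      simp only [hR]
      ring
    have hone : M⁻¹ * (d i / δ) * (M * (δ / d i)) = 1 := by field_simp
    simp only [mul_smul (d i / δ : ℝ), ← Finset.smul_sum]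
    rw [smul_smul, hsplit, smul_add, smul_smul, hone, one_smul, add_sub_cancel_left]
  rw [hbias, norm_smul, Real.norm_of_nonneg (by positivity)]
  calc M⁻¹ * (d i / δ) * ‖∑ s, R s • w s i‖
      ≤ M⁻¹ * (d i / δ) * (M * (L / 2 * (δ ^ 2 * Np))) := by
        gcongr
        refine (norm_sum_le_of_le _ (f := fun s => R s • w s i) fun s _ => ?_).trans_eq
          (by rw [Finset.sum_const, Finset.card_univ, nsmul_eq_mul])
        rw [norm_smul, hw', norm_signedBasisVector, mul_one]
        exact hRle s
    _ = d i * L * Np / 2 * δ := by field_simp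
end

section
/- Let X be a nonempty closed convex subset of ℝ^d, let v : X → ℝ^d be continuous, and let x* ∈ X be variationally stable: there is a neighborhood U of x* in X such that ⟨v(x), x − x*⟩ < 0 for all x ∈ U with x ≠ x*. Let h be a regularizer on X satisfying the regularity condition (R). Then x* is a primal attractor of the mirror dynamics: there exist constants β, V_E > 0 and a Lipschitz continuous, differentiable function E : ℝ^d → [0, ∞) with ‖∇E(y)‖ ≤ V_E and E(y') ≤ E(y) + ⟨y'−y, ∇E(y)⟩ + (β/2)‖y'−y‖_*² for all y, y', such that sup{⟨v(Q(y)), ∇E(y)⟩ : e₋ < E(y) < e₊} < 0 for all sufficiently small e₊ > e₋ > 0, and Q(y_k) → x* for every sequence (y_k) with E(y_k) → 0. -/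
open Filter Metric Set
open scoped RealInnerProductSpace Topology

section MirrorMap

variable {V : Type*} [NormedAddCommGroup V] [InnerProductSpace ℝ V]

/-- The Fenchel coupling `h p + h⋆ y - ⟪y, p⟫` between a primal point `p` and a dual vector `y`,
with the conjugate `h⋆ y` evaluated at the maximizer `Q y`. -/
noncomputable def fenchelCoupling (h : V → ℝ) (Q : V → V) (p y : V) : ℝ :=
  h p - (h (Q y) + ⟪y, p - Q y⟫)

theorem half_mul_norm_sq_le_fenchelCoupling {X : Set V} (hXcv : Convex ℝ X) {K : ℝ} {h : V → ℝ}
    (hhsc : ∀ x ∈ X, ∀ x' ∈ X, ∀ t ∈ Set.Icc (0:ℝ) 1,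
      h (t • x + (1 - t) • x') ≤
        t * h x + (1 - t) * h x' - K / 2 * t * (1 - t) * ‖x' - x‖ ^ 2)
    {Q : V → V} (hQ : ∀ y, Q y ∈ X ∧ ∀ z ∈ X, ⟪y, z⟫ - h z ≤ ⟪y, Q y⟫ - h (Q y))
    {p : V} (hp : p ∈ X) (y : V) :
    K / 2 * ‖Q y - p‖ ^ 2 ≤ fenchelCoupling h Q p y := by
  have key : ∀ t ∈ Ioo (0:ℝ) 1,
      K / 2 * (1 - t) * ‖Q y - p‖ ^ 2 ≤ fenchelCoupling h Q p y := by
    rintro t ⟨ht0, ht1⟩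
    have hsc := hhsc p hp (Q y) (hQ y).1 t ⟨ht0.le, ht1.le⟩
    have hmax := (hQ y).2 _ (hXcv hp (hQ y).1 ht0.le (sub_nonneg.2 ht1.le) (by ring))
    rw [inner_add_right, real_inner_smul_right, real_inner_smul_right] at hmax
    rw [fenchelCoupling, inner_sub_right]
    refine le_of_mul_le_mul_left ?_ ht0
    linarith
  have hlim : Tendsto (fun t : ℝ => K / 2 * (1 - t) * ‖Q y - p‖ ^ 2) (𝓝[>] 0)
      (𝓝 (K / 2 * (1 - 0) * ‖Q y - p‖ ^ 2)) :=
    (Continuous.tendsto (by fun_prop) 0).mono_left nhdsWithin_le_nhds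
  rw [sub_zero, mul_one] at hlim
  exact le_of_tendsto hlim (eventually_of_mem (Ioo_mem_nhdsGT one_pos) key)

theorem inner_le_fenchelCoupling_sub {X : Set V} {h : V → ℝ} {Q : V → V}
    (hQ : ∀ y, Q y ∈ X ∧ ∀ z ∈ X, ⟪y, z⟫ - h z ≤ ⟪y, Q y⟫ - h (Q y)) (p y z : V) :
    ⟪z - y, Q y - p⟫ ≤ fenchelCoupling h Q p z - fenchelCoupling h Q p y := by
  have := (hQ z).2 _ (hQ y).1
  simp only [fenchelCoupling, inner_sub_right, inner_sub_left]
  linarith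

theorem fenchelCoupling_sub_le {X : Set V} (hXcv : Convex ℝ X) {K : ℝ} (hK : 0 < K) {h : V → ℝ}
    (hhsc : ∀ x ∈ X, ∀ x' ∈ X, ∀ t ∈ Set.Icc (0:ℝ) 1,
      h (t • x + (1 - t) • x') ≤
        t * h x + (1 - t) * h x' - K / 2 * t * (1 - t) * ‖x' - x‖ ^ 2)
    {Q : V → V} (hQ : ∀ y, Q y ∈ X ∧ ∀ z ∈ X, ⟪y, z⟫ - h z ≤ ⟪y, Q y⟫ - h (Q y)) (p y z : V) :
    fenchelCoupling h Q p z - fenchelCoupling h Q p y ≤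
      ⟪z - y, Q y - p⟫ + 1 / (2 * K) * ‖z - y‖ ^ 2 := by
  have hstrong := half_mul_norm_sq_le_fenchelCoupling hXcv hhsc hQ (hQ z).1 y
  have hcs := real_inner_le_norm (z - y) (Q z - Q y)
  have hyoung : ‖z - y‖ * ‖Q z - Q y‖ ≤
      1 / (2 * K) * ‖z - y‖ ^ 2 + K / 2 * ‖Q z - Q y‖ ^ 2 := by
    have : 1 / (2 * K) * ‖z - y‖ ^ 2 + K / 2 * ‖Q z - Q y‖ ^ 2 - ‖z - y‖ * ‖Q z - Q y‖ =
        1 / (2 * K) * (‖z - y‖ - K * ‖Q z - Q y‖) ^ 2 := by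
      field_simp
      ring
    have : 0 ≤ 1 / (2 * K) * (‖z - y‖ - K * ‖Q z - Q y‖) ^ 2 := by positivity
    linarith
  rw [norm_sub_rev (Q y)] at hstrong
  simp only [fenchelCoupling, inner_sub_right, inner_sub_left] at *
  linarith

theorem hasGradientAt_of_abs_sub_le [CompleteSpace V] {f : V → ℝ} {g y : V} {C : ℝ}
    (hf : ∀ z, |f z - f y - ⟪z - y, g⟫| ≤ C * ‖z - y‖ ^ 2) : HasGradientAt f g y := by
  rw [hasGradientAt_iff_isLittleO]
  refine Asymptotics.IsBigO.trans_isLittleO (g := fun z => ‖z - y‖ ^ 2) ?_ ?_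
  · refine Asymptotics.IsBigO.of_bound C (Eventually.of_forall fun z => ?_)
    rw [real_inner_comm, Real.norm_eq_abs, Real.norm_of_nonneg (by positivity)]
    exact hf z
  · exact Asymptotics.isLittleO_pow_sub_sub y one_lt_two

theorem hasGradientAt_fenchelCoupling [CompleteSpace V] {X : Set V} (hXcv : Convex ℝ X)
    {K : ℝ} (hK : 0 < K) {h : V → ℝ}
    (hhsc : ∀ x ∈ X, ∀ x' ∈ X, ∀ t ∈ Set.Icc (0:ℝ) 1,
      h (t • x + (1 - t) • x') ≤
        t * h x + (1 - t) * h x' - K / 2 * t * (1 - t) * ‖x' - x‖ ^ 2)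
    {Q : V → V} (hQ : ∀ y, Q y ∈ X ∧ ∀ z ∈ X, ⟪y, z⟫ - h z ≤ ⟪y, Q y⟫ - h (Q y)) (p y : V) :
    HasGradientAt (fenchelCoupling h Q p) (Q y - p) y := by
  refine hasGradientAt_of_abs_sub_le (C := 1 / (2 * K)) fun z => abs_le.2 ⟨?_, ?_⟩
  · have := inner_le_fenchelCoupling_sub hQ p y z
    have : 0 ≤ 1 / (2 * K) * ‖z - y‖ ^ 2 := by positivity
    linarith
  · have := fenchelCoupling_sub_le hXcv hK hhsc hQ p y z
    linarith

theorem HasGradientAt.sqrt [CompleteSpace V] {f : V → ℝ} {g y : V} (hf : HasGradientAt f g y)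
    (hy : f y ≠ 0) : HasGradientAt (fun z => √(f z)) ((1 / (2 * √(f y))) • g) y := by
  rw [hasGradientAt_iff_hasFDerivAt] at hf ⊢
  simpa using HasFDerivAt.sqrt hf hy

theorem sqrt_sub_sqrt_le {a b : ℝ} (ha : 0 < a) (hb : 0 ≤ b) :
    √b - √a ≤ 1 / (2 * √a) * (b - a) := by
  have hs : 0 < √a := Real.sqrt_pos.2 ha
  rw [one_div, inv_mul_eq_div, le_div_iff₀ (by positivity)]
  nlinarith [sq_nonneg (√b - √a), Real.sq_sqrt ha.le, Real.sq_sqrt hb]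

end MirrorMap

/-- **Variationally stable states are primal attractors of the mirror dynamics.**
If `xstar` is variationally stable and the regularizer `h` satisfies the regularity
condition (R), then `xstar` is a primal attractor: there is a nonnegative, Lipschitz,
differentiable energy function `En` with bounded gradient and `β`-smooth, whose drift
`⟨v (Q y), ∇En y⟩` is uniformly negative on every band `{e₋ < En < e₊}` with
sufficiently small `e₊ > e₋ > 0`, and such that `Q (y k) → xstar` whenever
`En (y k) → 0`. -/
theorem primal_attractor_of_vs {d : ℕ}
    -- the feasible region
    {X : Set (EuclideanSpace ℝ (Fin d))}
    (hXne : X.Nonempty) (hXcl : IsClosed X) (hXcv : Convex ℝ X)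
    -- the payoff field and the variationally stable state
    {v : EuclideanSpace ℝ (Fin d) → EuclideanSpace ℝ (Fin d)}
    (hvcont : ContinuousOn v X)
    {xstar : EuclideanSpace ℝ (Fin d)} (hxstar : xstar ∈ X)
    (hVS : ∃ ε > 0, ∀ x ∈ X, x ≠ xstar → dist x xstar < ε → ⟪v x, x - xstar⟫ < 0)
    -- the regularizer: continuous and K-strongly convex on X
    {K : ℝ} (hK : 0 < K) {h : EuclideanSpace ℝ (Fin d) → ℝ}
    (hhcont : ContinuousOn h X)
    (hhsc : ∀ x ∈ X, ∀ x' ∈ X, ∀ t ∈ Set.Icc (0:ℝ) 1,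
      h (t • x + (1 - t) • x') ≤
        t * h x + (1 - t) * h x' - K / 2 * t * (1 - t) * ‖x' - x‖ ^ 2)
    -- the mirror map: Q y maximizes ⟪y, ·⟫ - h over X
    {Q : EuclideanSpace ℝ (Fin d) → EuclideanSpace ℝ (Fin d)}
    (hQ : ∀ y, Q y ∈ X ∧ ∀ z ∈ X, ⟪y, z⟫ - h z ≤ ⟪y, Q y⟫ - h (Q y))
    -- the regularity condition (R)
    (hR : ∀ x ∈ X, ∀ xk : ℕ → EuclideanSpace ℝ (Fin d), (∀ k, xk k ∈ X) →
      Tendsto xk atTop (𝓝 x) →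
      ∀ yk : ℕ → EuclideanSpace ℝ (Fin d),
        (∀ k, ∀ z ∈ X, h (xk k) + ⟪yk k, z - xk k⟫ ≤ h z) →
        Tendsto (fun k => h (xk k) + ⟪yk k, x - xk k⟫) atTop (𝓝 (h x))) :
    ∃ β VE : ℝ, 0 < β ∧ 0 < VE ∧ ∃ En : EuclideanSpace ℝ (Fin d) → ℝ,
      (∀ y, 0 ≤ En y) ∧
      (∃ CE : NNReal, LipschitzWith CE En) ∧
      Differentiable ℝ En ∧
      (∀ y, ‖gradient En y‖ ≤ VE) ∧
      (∀ y z, En z ≤ En y + ⟪z - y, gradient En y⟫ + β / 2 * ‖z - y‖ ^ 2) ∧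
      (∃ emax > 0, ∀ e₁ e₂ : ℝ, 0 < e₁ → e₁ < e₂ → e₂ ≤ emax →
        ∃ c > 0, ∀ y, e₁ < En y → En y < e₂ → ⟪v (Q y), gradient En y⟫ ≤ -c) ∧
      (∀ yk : ℕ → EuclideanSpace ℝ (Fin d),
        Tendsto (fun k => En (yk k)) atTop (𝓝 0) →
        Tendsto (fun k => Q (yk k)) atTop (𝓝 xstar)) := by
  obtain ⟨ε, hε, hVS⟩ := hVS
  set F := fenchelCoupling h Q xstar with hF
  have hFlow : ∀ y, K / 2 * ‖Q y - xstar‖ ^ 2 ≤ F y :=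
    half_mul_norm_sq_le_fenchelCoupling hXcv hhsc hQ hxstar
  have hF0 : ∀ y, 0 ≤ F y := fun y => le_trans (by positivity) (hFlow y)
  set En : EuclideanSpace ℝ (Fin d) → ℝ := fun y => √(1 + F y) - 1 with hEn
  have hs1 : ∀ y, 1 ≤ √(1 + F y) := fun y => Real.one_le_sqrt.2 (by linarith [hF0 y])
  have hsq : ∀ y, √(1 + F y) ^ 2 = 1 + F y := fun y => Real.sq_sqrt (by linarith [hF0 y])
  have hgrad : ∀ y, HasGradientAt En ((1 / (2 * √(1 + F y))) • (Q y - xstar)) y := fun y =>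
    (HasGradientAt.sqrt ((hasGradientAt_fenchelCoupling hXcv hK hhsc hQ xstar y).const_add 1)
      (by linarith [hF0 y])).sub_const 1
  have hge : ∀ y, gradient En y = (1 / (2 * √(1 + F y))) • (Q y - xstar) :=
    fun y => (hgrad y).gradient
  have hdiff : Differentiable ℝ En := fun y => (hgrad y).differentiableAt
  have hbound : ∀ y, ‖gradient En y‖ ≤ √(1 / (2 * K)) := by
    intro y
    have hs := hs1 y
    refine Real.le_sqrt_of_sq_le ?_
    rw [hge, norm_smul, Real.norm_of_nonneg (by positivity), mul_pow, div_pow, mul_pow, hsq,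
      div_mul_eq_mul_div, div_le_div_iff₀ (by linarith [hF0 y]) (by positivity)]
    nlinarith [hFlow y, hF0 y]
  have hcoef : ∀ y, 1 / (2 * √(1 + F y)) ≤ 1 := fun y => by
    rw [div_le_one (by linarith [hs1 y])]
    linarith [hs1 y]
  refine ⟨1 / K, √(1 / (2 * K)), by positivity, by positivity, En,
    fun y => sub_nonneg.2 (hs1 y), ⟨(√(1 / (2 * K))).toNNReal, ?_⟩, hdiff, hbound,
    ?_, ?_, ?_⟩
  · refine lipschitzWith_of_nnnorm_fderiv_le hdiff fun y => ?_
    rw [← NNReal.coe_le_coe, coe_nnnorm, Real.coe_toNNReal _ (Real.sqrt_nonneg _)]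
    refine le_of_eq_of_le ?_ (hbound y)
    rw [gradient, LinearIsometryEquiv.norm_map]
  · intro y z
    have hsub : √(1 + F z) - √(1 + F y) ≤ 1 / (2 * √(1 + F y)) * (1 + F z - (1 + F y)) :=
      sqrt_sub_sqrt_le (by linarith [hF0 y]) (by linarith [hF0 z])
    have hc0 : 0 ≤ 1 / (2 * √(1 + F y)) := by positivity
    have hquad : 0 ≤ 1 / (2 * K) * ‖z - y‖ ^ 2 := by positivity
    have h1 := mul_le_mul_of_nonneg_left (fenchelCoupling_sub_le hXcv hK hhsc hQ xstar y z) hc0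
    have h2 := mul_le_mul_of_nonneg_right (hcoef y) hquad
    have h3 : 1 / K / 2 * ‖z - y‖ ^ 2 = 1 / (2 * K) * ‖z - y‖ ^ 2 := by
      field_simp
    rw [hge, real_inner_smul_right, h3]
    simp only [hEn]
    linarith
  · have hr : 0 < K * ε ^ 2 / 4 := by positivity
    refine ⟨√(1 + K * ε ^ 2 / 4) - 1, ?_, ?_⟩
    · rw [gt_iff_lt, sub_pos, Real.lt_sqrt zero_le_one]
      linarith
    intro e₁ e₂ he₁ he₁₂ he₂
    by_contra! hcon
    choose y hy₁ hy₂ hyv using fun n : ℕ => hcon (1 / ((n : ℝ) + 1)) Nat.one_div_pos_of_nat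
    simp only [hEn] at hy₁ hy₂
    have hQnear : ∀ n, ‖Q (y n) - xstar‖ ≤ ε * (3 / 4) := by
      intro n
      have hlt : 1 + F (y n) < 1 + K * ε ^ 2 / 4 :=
        (Real.sqrt_lt_sqrt_iff (by linarith [hF0 (y n)])).1 (by linarith [hy₂ n])
      refine abs_le_of_sq_le_sq' ?_ (by positivity) |>.2
      have := hFlow (y n)
      refine le_of_mul_le_mul_left ?_ (half_pos hK)
      nlinarith [mul_pos hK (pow_pos hε 2)]
    obtain ⟨x, ⟨hxX, hxb⟩, φ, hφ, hφx⟩ :=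
      ((isCompact_closedBall xstar (ε * (3 / 4))).inter_left hXcl).tendsto_subseq
        (x := fun n => Q (y n))
        fun n => ⟨(hQ _).1, by rw [mem_closedBall, dist_eq_norm]; exact hQnear n⟩
    have hvlim : Tendsto (fun n => v (Q (y (φ n)))) atTop (𝓝 (v x)) :=
      (hvcont x hxX).tendsto.comp
        (tendsto_nhdsWithin_iff.2 ⟨hφx, Eventually.of_forall fun n => (hQ _).1⟩)
    have hdrift : ∀ n : ℕ, -(2 * (1 + e₂)) * (1 / ((n : ℝ) + 1)) ≤
        ⟪v (Q (y n)), Q (y n) - xstar⟫ := by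
      intro n
      have hs : 0 < √(1 + F (y n)) := by linarith [hs1 (y n)]
      have := hyv n
      rw [hge, real_inner_smul_right, one_div_mul_eq_div, lt_div_iff₀ (by positivity)] at this
      have hpos : 0 < 1 / ((n : ℝ) + 1) := Nat.one_div_pos_of_nat
      nlinarith [hy₂ n]
    have hlim0 : Tendsto (fun n : ℕ => -(2 * (1 + e₂)) * (1 / ((φ n : ℝ) + 1))) atTop (𝓝 0) := by
      simpa using ((tendsto_one_div_add_atTop_nhds_zero_nat (𝕜 := ℝ)).comp
        hφ.tendsto_atTop).const_mul (-(2 * (1 + e₂)))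
    have hnonneg : 0 ≤ ⟪v x, x - xstar⟫ :=
      le_of_tendsto_of_tendsto' hlim0 (hvlim.inner (hφx.sub_const xstar)) fun n => hdrift (φ n)
    have hx : x = xstar := by
      by_contra hne
      exact (hVS x hxX hne (lt_of_le_of_lt (mem_closedBall.1 hxb) (by linarith))).not_ge hnonneg
    subst hx
    have hRlim := hR x hxX (fun n => Q (y (φ n))) (fun n => (hQ _).1) hφx (fun n => y (φ n))
      fun n z hz => by
        have := (hQ (y (φ n))).2 z hz
        rw [inner_sub_right]
        linarith
    have hFlim : Tendsto (fun n => √(1 + F (y (φ n))) - 1) atTop (𝓝 0) := by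
      simpa [hF, fenchelCoupling] using (((hRlim.const_sub (h x)).const_add 1).sqrt).sub_const 1
    exact (ge_of_tendsto' hFlim fun n => (hy₁ (φ n)).le).not_gt he₁
  · intro y hy
    have hFlim : Tendsto (fun k => F (y k)) atTop (𝓝 0) := by
      have : Tendsto (fun k => (En (y k) + 1) ^ 2 - 1) atTop (𝓝 ((0 + 1) ^ 2 - 1)) :=
        ((hy.add_const 1).pow 2).sub_const 1
      simpa [hEn, hsq] using this
    have hsqlim : Tendsto (fun k => ‖Q (y k) - xstar‖ ^ 2) atTop (𝓝 0) := by
      refine squeeze_zero (g := fun k => 2 / K * F (y k)) (fun k => by positivity) (fun k => ?_)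
        (by simpa using hFlim.const_mul (2 / K))
      rw [div_mul_eq_mul_div, le_div_iff₀ hK]
      linarith [hFlow (y k)]
    rw [tendsto_iff_norm_sub_tendsto_zero]
    simpa [Real.sqrt_sq] using hsqlim.sqrt
end

section
/- In the MRM setup with energy function E and threshold e_max > inf E, suppose that for each e₋ ∈ (inf E, e_max) one has sup{Ė(y) : e₋ ≤ E(y) ≤ e_max} < 0, where Ė(y) = ⟨v(Q(y)), ∇E(y)⟩. Let H be the event {y_n ∈ D for all n}, where D = {y : E(y) ≤ e_max}, and suppose P(H) > 0, τ_n = Σ_{k≤n} γ_k → ∞, and the sublinearity condition (Sub) holds: S_n/τ_n → 0, R_n/τ_n → 0 and T_n/τ_n → 0 almost surely. Then P(liminf_{n→∞} E(y_n) = inf E | H) = 1. -/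
open MeasureTheory Filter Metric Set
open scoped RealInnerProductSpace ENNReal Topology

/-- The mirror map of a `K`-strongly convex regularizer is `(2 / K)`-Lipschitz. -/
lemma lipschitzWith_mirrorMap {F : Type*} [NormedAddCommGroup F] [InnerProductSpace ℝ F]
    {X : Set F} (hXcv : Convex ℝ X) {K : ℝ} (hK : 0 < K) {h : F → ℝ}
    (hhsc : ∀ x ∈ X, ∀ x' ∈ X, ∀ t ∈ Set.Icc (0:ℝ) 1,
      h (t • x + (1 - t) • x') ≤
        t * h x + (1 - t) * h x' - K / 2 * t * (1 - t) * ‖x' - x‖ ^ 2)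
    {Q : F → F} (hQ : ∀ y, Q y ∈ X ∧ ∀ z ∈ X, ⟪y, z⟫ - h z ≤ ⟪y, Q y⟫ - h (Q y)) :
    LipschitzWith (Real.toNNReal (2 / K)) Q := by
  have growth : ∀ y, ∀ z ∈ X,
      K / 4 * ‖Q y - z‖ ^ 2 ≤ (⟪y, Q y⟫ - h (Q y)) - (⟪y, z⟫ - h z) := by
    intro y z hz
    have hmem : (1 / 2 : ℝ) • z + (1 - 1 / 2 : ℝ) • Q y ∈ X :=
      hXcv hz (hQ y).1 (by norm_num) (by norm_num) (by norm_num)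
    have hmax := (hQ y).2 _ hmem
    have hsc := hhsc z hz (Q y) (hQ y).1 (1 / 2) ⟨by norm_num, by norm_num⟩
    rw [inner_add_right, inner_smul_right, inner_smul_right] at hmax
    nlinarith
  refine LipschitzWith.of_dist_le_mul fun y y' => ?_
  rw [Real.coe_toNNReal _ (by positivity), dist_eq_norm, dist_eq_norm]
  have h₁ := growth y (Q y') (hQ y').1
  have h₂ := growth y' (Q y) (hQ y).1
  rw [norm_sub_rev] at h₂
  have hinner : ⟪y - y', Q y - Q y'⟫ = ⟪y, Q y⟫ - ⟪y, Q y'⟫ - ⟪y', Q y⟫ + ⟪y', Q y'⟫ := by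
    rw [inner_sub_left, inner_sub_right, inner_sub_right]; ring
  have hcs := real_inner_le_norm (y - y') (Q y - Q y')
  have hsq : K / 2 * ‖Q y - Q y'‖ * ‖Q y - Q y'‖ ≤ ‖y - y'‖ * ‖Q y - Q y'‖ := by nlinarith
  rw [div_mul_eq_mul_div, le_div_iff₀ hK]
  rcases (norm_nonneg (Q y - Q y')).eq_or_lt with h0 | hpos
  · rw [← h0]; simp
  · have := le_of_mul_le_mul_right hsq hpos
    linarith

/-- A real sequence whose increments are eventually at most `-c * γ n` for a fixed `c > 0`, up to
errors that are sublinear with respect to `∑ γ`, is not bounded below. -/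
lemma not_bddBelow_range_of_drift {a γ e : ℕ → ℝ} (hγpos : ∀ n, 0 < γ n) (hγdiv : ¬ Summable γ)
    {c : ℝ} (hc : 0 < c) (hstep : ∀ᶠ n in atTop, a (n + 1) ≤ a n - c * γ n + e n)
    (he : Tendsto (fun n => (∑ k ∈ Finset.range (n + 1), e k) /
      (∑ k ∈ Finset.range (n + 1), γ k)) atTop (𝓝 0)) :
    ¬ BddBelow (Set.range a) := by
  rintro ⟨m, hm⟩
  obtain ⟨N, hN⟩ := eventually_atTop.1 hstep
  let f : ℕ → ℝ := fun n =>
    a n + c * ∑ k ∈ Finset.range n, γ k - ∑ k ∈ Finset.range n, e k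
  have hf : ∀ n, N ≤ n → f n ≤ f N := by
    intro n hn
    induction n, hn using Nat.le_induction with
    | base => exact le_rfl
    | succ n hn ih =>
      refine le_trans ?_ ih
      simp only [f, Finset.sum_range_succ]
      linarith [hN n hn]
  have hτ : Tendsto (fun n => ∑ k ∈ Finset.range (n + 1), γ k) atTop atTop :=
    (tendsto_add_atTop_iff_nat 1).2
      ((not_summable_iff_tendsto_nat_atTop_of_nonneg fun n => (hγpos n).le).1 hγdiv)
  have hlim : Tendsto (fun n => (f N - m) / (∑ k ∈ Finset.range (n + 1), γ k) +
      (∑ k ∈ Finset.range (n + 1), e k) / (∑ k ∈ Finset.range (n + 1), γ k)) atTop (𝓝 (0 + 0)) :=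
    (hτ.const_div_atTop _).add he
  have hle : c ≤ 0 + 0 := by
    refine ge_of_tendsto hlim ?_
    filter_upwards [eventually_ge_atTop N, hτ.eventually_gt_atTop 0] with n hn hpos
    rw [← add_div, le_div_iff₀ hpos]
    have h₁ := hf (n + 1) (by omega)
    have h₂ : m ≤ a (n + 1) := hm ⟨n + 1, rfl⟩
    have h₃ : f (n + 1) = a (n + 1) + c * ∑ k ∈ Finset.range (n + 1), γ k
      - ∑ k ∈ Finset.range (n + 1), e k := rfl
    linarith
  linarith

/-- **Subsequence extraction for (MRM).**
If the drift of the energy `En` is strictly negative on every band `{e₋ ≤ En ≤ emax}`,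
the event `H` that the iterates remain in the sublevel set `D = {En ≤ emax}` has positive
probability, and the sublinearity condition (Sub) holds, then, conditionally on `H`,
`liminf_n En (y n) = inf En` almost surely. -/
theorem mrm_liminf_energy {d : ℕ}
    -- the feasible region
    {X : Set (EuclideanSpace ℝ (Fin d))}
    (hXne : X.Nonempty) (hXcl : IsClosed X) (hXcv : Convex ℝ X)
    -- the regularizer: continuous and K-strongly convex on X
    {K : ℝ} (hK : 0 < K) {h : EuclideanSpace ℝ (Fin d) → ℝ}
    (hhcont : ContinuousOn h X)
    (hhsc : ∀ x ∈ X, ∀ x' ∈ X, ∀ t ∈ Set.Icc (0:ℝ) 1,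
      h (t • x + (1 - t) • x') ≤
        t * h x + (1 - t) * h x' - K / 2 * t * (1 - t) * ‖x' - x‖ ^ 2)
    -- the mirror map: Q y maximizes ⟪y, ·⟫ - h over X
    {Q : EuclideanSpace ℝ (Fin d) → EuclideanSpace ℝ (Fin d)}
    (hQ : ∀ y, Q y ∈ X ∧ ∀ z ∈ X, ⟪y, z⟫ - h z ≤ ⟪y, Q y⟫ - h (Q y))
    -- the payoff field: Lipschitz and bounded on X
    {v : EuclideanSpace ℝ (Fin d) → EuclideanSpace ℝ (Fin d)} {Lv G : ℝ}
    (hvLip : LipschitzOnWith (Real.toNNReal Lv) v X)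
    (hvG : ∀ z ∈ X, ‖v z‖ ≤ G)
    -- the probability space, filtration and processes
    {Ω : Type*} [m0 : MeasurableSpace Ω] {μ : Measure Ω} [IsProbabilityMeasure μ]
    {ℱ : Filtration ℕ m0} {γ B : ℕ → ℝ}
    (hγpos : ∀ n, 0 < γ n) (hγdiv : ¬ Summable γ)
    {y x g U b : ℕ → Ω → EuclideanSpace ℝ (Fin d)}
    (hyadapt : ∀ n, Measurable[ℱ n] (y n))
    (hrec : ∀ n ω, y (n + 1) ω = y n ω + γ n • g n ω)
    (hxQ : ∀ n ω, x n ω = Q (y n ω))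
    (hU : ∀ n ω, U n ω = g n ω - (μ[g n|ℱ n]) ω)
    (hb : ∀ n ω, b n ω = (μ[g n|ℱ n]) ω - v (x n ω))
    (hB : ∀ n, ∀ᵐ ω ∂μ, (μ[(fun ω' => ‖b n ω'‖)|ℱ n]) ω ≤ B n)
    -- the energy function `En`, its infimum, and the threshold `emax`
    {En : EuclideanSpace ℝ (Fin d) → ℝ} {LE VE β Einf emax : ℝ}
    (hELip : LipschitzWith (Real.toNNReal LE) En) (hEdiff : Differentiable ℝ En)
    (hEgrad : ∀ z, ‖gradient En z‖ ≤ VE)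
    (hEsmooth : ∀ z z', En z' ≤ En z + ⟪z' - z, gradient En z⟫ + β / 2 * ‖z' - z‖ ^ 2)
    (hEinf : IsGLB (Set.range En) Einf)
    (hdrift : ∀ e₁, Einf < e₁ → e₁ < emax → ∃ c > 0, ∀ z,
      e₁ ≤ En z → En z ≤ emax → ⟪v (Q z), gradient En z⟫ ≤ -c)
    -- the event `H`
    (hH : 0 < μ {ω | ∀ n, En (y n ω) ≤ emax})
    -- the sublinearity condition (Sub)
    (hSubS : ∀ᵐ ω ∂μ, Tendsto (fun n => (∑ k ∈ Finset.range (n + 1),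
          γ k * ⟪U k ω, gradient En (y k ω)⟫) /
        (∑ k ∈ Finset.range (n + 1), γ k)) atTop (𝓝 0))
    (hSubR : Tendsto (fun n => (∑ k ∈ Finset.range (n + 1), γ k * (VE * B k)) /
        (∑ k ∈ Finset.range (n + 1), γ k)) atTop (𝓝 0))
    (hSubT : ∀ᵐ ω ∂μ, Tendsto (fun n => (∑ k ∈ Finset.range (n + 1),
          γ k ^ 2 * (β / 2 * ‖g k ω‖ ^ 2)) /
        (∑ k ∈ Finset.range (n + 1), γ k)) atTop (𝓝 0)) :
    ProbabilityTheory.cond μ {ω | ∀ n, En (y n ω) ≤ emax}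
      {ω | Filter.liminf (fun n => En (y n ω)) atTop = Einf} = 1 := by
  have hvQ : Continuous fun z => v (Q z) :=
    hvLip.continuousOn.comp_continuous (lipschitzWith_mirrorMap hXcv hK hhsc hQ).continuous
      fun z => (hQ z).1
  have hbB : ∀ᵐ ω ∂μ, ∀ n, ‖b n ω‖ ≤ B n := by
    refine ae_all_iff.2 fun n => ?_
    have hvx : StronglyMeasurable[ℱ n] fun ω => v (x n ω) := by
      simp only [hxQ]
      exact (hvQ.measurable.comp (hyadapt n)).stronglyMeasurable
    have hvxint : Integrable (fun ω => v (x n ω)) μ := by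
      refine Integrable.of_bound (hvx.mono (ℱ.le n)).aestronglyMeasurable G
        (Eventually.of_forall fun ω => ?_)
      rw [hxQ]
      exact hvG _ (hQ _).1
    have hbn : b n = fun ω => (μ[g n|ℱ n]) ω - v (x n ω) := funext (hb n)
    have hbmeas : StronglyMeasurable[ℱ n] fun ω => ‖b n ω‖ := by
      rw [hbn]
      exact (stronglyMeasurable_condExp.sub hvx).norm
    have hbint : Integrable (fun ω => ‖b n ω‖) μ := by
      rw [hbn]
      exact (integrable_condExp.sub hvxint).norm
    have hBn := hB n
    rwa [condExp_of_stronglyMeasurable (ℱ.le n) hbmeas hbint] at hBn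
  have hHmeas : MeasurableSet {ω | ∀ n, En (y n ω) ≤ emax} := by
    rw [Set.ext fun ω => show ω ∈ {ω | ∀ n, En (y n ω) ≤ emax} ↔
      ω ∈ ⋂ n, {ω | En (y n ω) ≤ emax} by simp]
    exact MeasurableSet.iInter fun n => measurableSet_le
      (hELip.continuous.measurable.comp ((hyadapt n).mono (ℱ.le n) le_rfl)) measurable_const
  have hVE : 0 ≤ VE := (norm_nonneg _).trans (hEgrad 0)
  have hlow : ∀ z, Einf ≤ En z := fun z => hEinf.1 ⟨z, rfl⟩
  have hmain : ∀ᵐ ω ∂μ, (∀ n, En (y n ω) ≤ emax) →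
      Filter.liminf (fun n => En (y n ω)) atTop = Einf := by
    filter_upwards [hbB, hSubS, hSubT] with ω hbω hS hT hω
    have hbdd : IsBoundedUnder (· ≥ ·) atTop fun n => En (y n ω) :=
      isBoundedUnder_of ⟨Einf, fun n => hlow _⟩
    have hcobdd : IsCoboundedUnder (· ≥ ·) atTop fun n => En (y n ω) :=
      (isBoundedUnder_of ⟨emax, hω⟩ : IsBoundedUnder (· ≤ ·) atTop _).isCoboundedUnder_ge
    refine le_antisymm ?_ (le_liminf_of_le hcobdd (Eventually.of_forall fun n => hlow _))
    by_contra! hlt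
    obtain ⟨e₁, he₁, he₁'⟩ := exists_between hlt
    have hev : ∀ᶠ n in atTop, e₁ < En (y n ω) := eventually_lt_of_lt_liminf he₁' hbdd
    obtain ⟨n₀, hn₀⟩ := hev.exists
    obtain ⟨c, hc, hdr⟩ := hdrift e₁ he₁ (hn₀.trans_le (hω n₀))
    refine not_bddBelow_range_of_drift (a := fun n => En (y n ω)) hγpos hγdiv hc
      (e := fun k => γ k * ⟪U k ω, gradient En (y k ω)⟫ + γ k * (VE * B k) +
        γ k ^ 2 * (β / 2 * ‖g k ω‖ ^ 2)) ?_ ?_ ⟨Einf, ?_⟩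
    · filter_upwards [hev] with n hn
      have hsm := hEsmooth (y n ω) (y (n + 1) ω)
      have hg : g n ω = v (Q (y n ω)) + U n ω + b n ω := by
        rw [hU, hb, hxQ]; abel
      have hdiff : y (n + 1) ω - y n ω = γ n • g n ω := by rw [hrec]; abel
      have hbn : ⟪b n ω, gradient En (y n ω)⟫ ≤ VE * B n :=
        calc ⟪b n ω, gradient En (y n ω)⟫
            ≤ ‖b n ω‖ * ‖gradient En (y n ω)‖ := real_inner_le_norm _ _
          _ ≤ ‖b n ω‖ * VE := by gcongr; exact hEgrad _
          _ ≤ B n * VE := by gcongr; exact hbω n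
          _ = VE * B n := mul_comm _ _
      have hinner : ⟪g n ω, gradient En (y n ω)⟫ ≤
          -c + ⟪U n ω, gradient En (y n ω)⟫ + VE * B n := by
        rw [hg, inner_add_left, inner_add_left]
        linarith [hdr _ hn.le (hω n)]
      have hmul := mul_le_mul_of_nonneg_left hinner (hγpos n).le
      rw [hdiff, real_inner_smul_left, norm_smul, mul_pow, Real.norm_eq_abs, sq_abs] at hsm
      linarith
    · simpa [Finset.sum_add_distrib, add_div] using (hS.add hSubR).add hT
    · rintro _ ⟨n, rfl⟩
      exact hlow _
  have := ProbabilityTheory.cond_isProbabilityMeasure hH.ne'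
  have hcond : ∀ᵐ ω ∂(ProbabilityTheory.cond μ {ω | ∀ n, En (y n ω) ≤ emax}),
      Filter.liminf (fun n => En (y n ω)) atTop = Einf := by
    filter_upwards [ProbabilityTheory.cond_absolutelyContinuous.ae_le hmain,
      ProbabilityTheory.ae_cond_mem hHmeas] with ω h₁ h₂ using h₁ h₂
  exact (measure_congr (eventuallyEq_univ.2 hcond)).trans measure_univ
end

section
/- In the MRM setup, let S ⊆ X be globally coherent with deviation directions W = {w_1, …, w_m}, and assume the uniform gap c := −sup{⟨v(x), w⟩ : x ∈ X, w ∈ W} > 0 (which holds, e.g., when X is compact). Suppose the aggregate errors are almost surely sublinear in the effective time τ_n = Σ_{k≤n} γ_k: for each w ∈ W, (1/τ_n) Σ_{k=1}^n γ_k ⟨U_k, w⟩ → 0 almost surely, and (1/τ_n) Σ_{k=1}^n γ_k B_k → 0. Then dist(x_n, S) → 0 almost surely. -/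
open MeasureTheory Filter Metric Set
open scoped RealInnerProductSpace ENNReal Topology

/-- The mirror map induced by a strongly convex regularizer is Lipschitz continuous. -/
lemma lipschitzWith_of_forall_inner_sub_le {E : Type*} [NormedAddCommGroup E]
    [InnerProductSpace ℝ E] {X : Set E} (hX : Convex ℝ X) {K : ℝ} (hK : 0 < K) {h : E → ℝ}
    (hh : ∀ x ∈ X, ∀ x' ∈ X, ∀ t ∈ Set.Icc (0:ℝ) 1,
      h (t • x + (1 - t) • x') ≤
        t * h x + (1 - t) * h x' - K / 2 * t * (1 - t) * ‖x' - x‖ ^ 2)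
    {Q : E → E} (hQ : ∀ y, Q y ∈ X ∧ ∀ z ∈ X, ⟪y, z⟫ - h z ≤ ⟪y, Q y⟫ - h (Q y)) :
    LipschitzWith (Real.toNNReal (2 / K)) Q := by
  have key : ∀ y, ∀ z ∈ X,
      ⟪y, z⟫ - ⟪y, Q y⟫ - h z + h (Q y) + K / 4 * ‖Q y - z‖ ^ 2 ≤ 0 := by
    intro y z hz
    have hmid : (1 / 2 : ℝ) • z + (1 - 1 / 2 : ℝ) • Q y ∈ X :=
      hX hz (hQ y).1 (by norm_num) (by norm_num) (by norm_num)
    have h1 := (hQ y).2 _ hmid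
    have h2 := hh z hz (Q y) (hQ y).1 (1 / 2) ⟨by norm_num, by norm_num⟩
    rw [inner_add_right, real_inner_smul_right, real_inner_smul_right] at h1
    linarith
  refine LipschitzWith.of_dist_le_mul fun y y' => ?_
  rw [Real.coe_toNNReal _ (by positivity), dist_eq_norm, dist_eq_norm]
  have h1 := key y (Q y') (hQ y').1
  have h2 := key y' (Q y) (hQ y).1
  rw [norm_sub_rev (Q y') (Q y)] at h2
  have h3 : ⟪y - y', Q y - Q y'⟫ ≤ ‖y - y'‖ * ‖Q y - Q y'‖ := real_inner_le_norm _ _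
  rw [inner_sub_left, inner_sub_right, inner_sub_right] at h3
  rcases (norm_nonneg (Q y - Q y')).eq_or_lt with h0 | h0
  · rw [← h0]
    positivity
  · have h4 : K / 2 * ‖Q y - Q y'‖ ≤ ‖y - y'‖ := by
      refine le_of_mul_le_mul_right ?_ h0
      nlinarith
    rw [div_mul_eq_mul_div, le_div_iff₀ hK]
    linarith

/-- A real sequence with drift bounded above by a negative constant, up to errors that are
sublinear in the effective time, tends to `-∞`. -/
lemma tendsto_atBot_of_drift_le {γ u β p : ℕ → ℝ} {c r : ℝ} (hc : 0 < c)
    (hγpos : ∀ n, 0 < γ n) (hγdiv : ¬ Summable γ)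
    (hp : ∀ n, p (n + 1) ≤ p n + γ n * (-c + u n + r * β n))
    (hu : Tendsto (fun n => (∑ k ∈ Finset.range (n + 1), γ k * u k) /
      (∑ k ∈ Finset.range (n + 1), γ k)) atTop (𝓝 0))
    (hβ : Tendsto (fun n => (∑ k ∈ Finset.range (n + 1), γ k * β k) /
      (∑ k ∈ Finset.range (n + 1), γ k)) atTop (𝓝 0)) :
    Tendsto p atTop atBot := by
  have hτ : Tendsto (fun n => ∑ k ∈ Finset.range (n + 1), γ k) atTop atTop :=
    ((not_summable_iff_tendsto_nat_atTop_of_nonneg fun n => (hγpos n).le).1 hγdiv).comp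
      (tendsto_add_atTop_nat 1)
  have hsum : ∀ n, p n ≤ p 0 + (-c * ∑ k ∈ Finset.range n, γ k +
      ∑ k ∈ Finset.range n, γ k * u k + r * ∑ k ∈ Finset.range n, γ k * β k) := by
    intro n
    induction n with
    | zero => simp
    | succ n ih =>
      simp only [Finset.sum_range_succ]
      linarith [hp n]
  have hlim : Tendsto (fun n => -c + (∑ k ∈ Finset.range (n + 1), γ k * u k) /
      (∑ k ∈ Finset.range (n + 1), γ k) + r * ((∑ k ∈ Finset.range (n + 1), γ k * β k) /
      (∑ k ∈ Finset.range (n + 1), γ k))) atTop (𝓝 (-c)) := by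
    simpa using (hu.const_add (-c)).add (hβ.const_mul r)
  have hbot := tendsto_atBot_add_const_left atTop (p 0)
    (hτ.atTop_mul_neg (neg_lt_zero.2 hc) hlim)
  refine (tendsto_add_atTop_iff_nat 1).1 (tendsto_atBot_mono (fun n => ?_) hbot)
  refine (hsum (n + 1)).trans_eq ?_
  have hpos : 0 < ∑ k ∈ Finset.range (n + 1), γ k :=
    Finset.sum_pos (fun k _ => hγpos k) (by simp)
  field_simp

/-- **Convergence of (MRM) to a globally coherent set.**
If `S` is globally coherent with deviation directions `w 1, …, w m`, with a uniform gap
`⟪v x, w i⟫ ≤ -c < 0` over all of `X`, and the aggregate errors are almost surely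
sublinear in the effective time `τ n = ∑_{k ≤ n} γ k`, then the sequence of play
`x n = Q (y n)` converges to `S` almost surely. -/
theorem mrm_converges_to_globally_coherent {d m : ℕ} (hm : 0 < m)
    -- the feasible region
    {X : Set (EuclideanSpace ℝ (Fin d))}
    (hXne : X.Nonempty) (hXcl : IsClosed X) (hXcv : Convex ℝ X)
    -- the regularizer: continuous and K-strongly convex on X
    {K : ℝ} (hK : 0 < K) {h : EuclideanSpace ℝ (Fin d) → ℝ}
    (hhcont : ContinuousOn h X)
    (hhsc : ∀ x ∈ X, ∀ x' ∈ X, ∀ t ∈ Set.Icc (0:ℝ) 1,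
      h (t • x + (1 - t) • x') ≤
        t * h x + (1 - t) * h x' - K / 2 * t * (1 - t) * ‖x' - x‖ ^ 2)
    -- the mirror map: Q y maximizes ⟪y, ·⟫ - h over X
    {Q : EuclideanSpace ℝ (Fin d) → EuclideanSpace ℝ (Fin d)}
    (hQ : ∀ y, Q y ∈ X ∧ ∀ z ∈ X, ⟪y, z⟫ - h z ≤ ⟪y, Q y⟫ - h (Q y))
    -- the payoff field: Lipschitz and bounded on X
    {v : EuclideanSpace ℝ (Fin d) → EuclideanSpace ℝ (Fin d)} {Lv G : ℝ}
    (hvLip : LipschitzOnWith (Real.toNNReal Lv) v X)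
    (hvG : ∀ z ∈ X, ‖v z‖ ≤ G)
    -- the probability space, filtration and processes
    {Ω : Type*} [m0 : MeasurableSpace Ω] {μ : Measure Ω} [IsProbabilityMeasure μ]
    {ℱ : Filtration ℕ m0} {γ B : ℕ → ℝ}
    (hγpos : ∀ n, 0 < γ n) (hγdiv : ¬ Summable γ)
    {y x g U b : ℕ → Ω → EuclideanSpace ℝ (Fin d)}
    (hyadapt : ∀ n, Measurable[ℱ n] (y n))
    (hrec : ∀ n ω, y (n + 1) ω = y n ω + γ n • g n ω)
    (hxQ : ∀ n ω, x n ω = Q (y n ω))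
    (hU : ∀ n ω, U n ω = g n ω - (μ[g n|ℱ n]) ω)
    (hb : ∀ n ω, b n ω = (μ[g n|ℱ n]) ω - v (x n ω))
    (hB : ∀ n, ∀ᵐ ω ∂μ, (μ[(fun ω' => ‖b n ω'‖)|ℱ n]) ω ≤ B n)
    -- `S` is globally coherent with deviation directions `w`
    {S : Set (EuclideanSpace ℝ (Fin d))}
    (hSne : S.Nonempty) (hScpt : IsCompact S) (hSX : S ⊆ X)
    {w : Fin m → EuclideanSpace ℝ (Fin d)}
    (hcohS : ∀ z ∈ S, ∀ i, ⟪v z, w i⟫ < 0)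
    (htarget : ∀ yk : ℕ → EuclideanSpace ℝ (Fin d),
      (∀ i, Tendsto (fun k => ⟪yk k, w i⟫) atTop atBot) →
      Tendsto (fun k => infDist (Q (yk k)) S) atTop (𝓝 0))
    -- the uniform gap over all of `X`
    {c : ℝ} (hc : 0 < c) (hgap : ∀ z ∈ X, ∀ i, ⟪v z, w i⟫ ≤ -c)
    -- sublinearity of the aggregate errors in the effective time
    (hSubU : ∀ i, ∀ᵐ ω ∂μ,
      Tendsto (fun n => (∑ k ∈ Finset.range (n + 1), γ k * ⟪U k ω, w i⟫) /
        (∑ k ∈ Finset.range (n + 1), γ k)) atTop (𝓝 0))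
    (hSubB : Tendsto (fun n => (∑ k ∈ Finset.range (n + 1), γ k * B k) /
        (∑ k ∈ Finset.range (n + 1), γ k)) atTop (𝓝 0)) :
    ∀ᵐ ω ∂μ, Tendsto (fun n => infDist (x n ω) S) atTop (𝓝 0) := by
  have hvQ : Continuous fun z => v (Q z) :=
    hvLip.continuousOn.comp_continuous
      (lipschitzWith_of_forall_inner_sub_le hXcv hK hhsc hQ).continuous fun z => (hQ z).1
  have hbB : ∀ n, ∀ᵐ ω ∂μ, ‖b n ω‖ ≤ B n := by
    intro n
    have hvm : StronglyMeasurable[ℱ n] fun ω => v (Q (y n ω)) :=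
      (hvQ.measurable.comp (hyadapt n)).stronglyMeasurable
    have hvi : Integrable (fun ω => v (Q (y n ω))) μ :=
      Integrable.of_bound (hvm.mono (ℱ.le n)).aestronglyMeasurable G
        (ae_of_all _ fun ω => hvG _ (hQ _).1)
    have hb' : b n = μ[g n|ℱ n] - fun ω => v (Q (y n ω)) := by
      funext ω
      simp [hb, hxQ]
    have hbm : StronglyMeasurable[ℱ n] (b n) := hb' ▸ stronglyMeasurable_condExp.sub hvm
    have hbi : Integrable (b n) μ := hb' ▸ integrable_condExp.sub hvi
    simpa only [condExp_of_stronglyMeasurable (ℱ.le n) hbm.norm hbi.norm] using hB n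
  filter_upwards [ae_all_iff.2 hbB, ae_all_iff.2 hSubU] with ω hbω hUω
  simp only [hxQ]
  refine htarget (fun n => y n ω) fun i => ?_
  refine tendsto_atBot_of_drift_le (r := ‖w i‖) hc hγpos hγdiv (fun n => ?_) (hUω i) hSubB
  have hg : g n ω = v (x n ω) + U n ω + b n ω := by
    rw [hU, hb]
    abel
  have hv : ⟪v (x n ω), w i⟫ ≤ -c := hgap _ (hxQ n ω ▸ (hQ _).1) i
  have hbw : ⟪b n ω, w i⟫ ≤ ‖w i‖ * B n := by
    rw [mul_comm]
    exact (real_inner_le_norm _ _).trans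
      (mul_le_mul_of_nonneg_right (hbω n) (norm_nonneg _))
  rw [hrec, inner_add_left, real_inner_smul_left, hg, inner_add_left, inner_add_left]
  have := mul_le_mul_of_nonneg_left (add_le_add (add_le_add_left hv ⟪U n ω, w i⟫) hbw)
    (hγpos n).le
  linarith
end
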